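/- arXiv:2310.01742 — 3 statements merged into one kernel-verified Lean document; each statement's English description precedes it below -/
import Mathlib

section
/- The function g(x) = ln(1+x) - 3 + 3/(1+x) is strictly decreasing on the interval (0,2), strictly increasing on the interval (2,∞), and satisfies g(x) < 0 for all x ∈ (0,2]. -/
/-- `g x = ln (1 + x) - 3 + 3 / (1 + x)`. -/
noncomputable def g (x : ℝ) : ℝ := Real.log (1 + x) - 3 + 3 / (1 + x)

theorem g_hasDerivAt (x : ℝ) (hx : 0 ≤ x) : HasDerivAt g ((x - 2) / (1 + x) ^ 2) x := by
  have h0 : (1 + x) ≠ 0 := by positivity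
  have h1 : HasDerivAt (fun y : ℝ => 1 + y) 1 x := (hasDerivAt_id x).const_add 1
  have h2 := ((h1.log h0).sub_const 3).add ((hasDerivAt_const x (3 : ℝ)).div h1 h0)
  have h3 : HasDerivAt g _ x := h2
  convert h3 using 1
  field_simp
  ring

theorem g_anti : StrictAntiOn g (Set.Icc 0 2) := by
  apply strictAntiOn_of_deriv_neg (convex_Icc 0 2)
  · intro x hx
    exact (g_hasDerivAt x hx.1).continuousAt.continuousWithinAt
  · intro x hx
    rw [interior_Icc] at hx
    rw [(g_hasDerivAt x hx.1.le).deriv]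
    have := hx.1
    exact div_neg_of_neg_of_pos (by linarith [hx.2]) (by positivity)

theorem g_mono : StrictMonoOn g (Set.Ici 2) := by
  apply strictMonoOn_of_deriv_pos (convex_Ici 2)
  · intro x hx
    exact (g_hasDerivAt x (le_trans (by norm_num) hx)).continuousAt.continuousWithinAt
  · intro x hx
    rw [interior_Ici] at hx
    have h2 : 2 < x := hx
    rw [(g_hasDerivAt x (by linarith)).deriv]
    exact div_pos (by linarith) (by positivity)

/-- `g` is strictly decreasing on `(0, 2)`, strictly increasing on `(2, ∞)`, and
`g x < 0` for all `x ∈ (0, 2]`. -/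
theorem stmt_1 :
    StrictAntiOn g (Set.Ioo 0 2) ∧ StrictMonoOn g (Set.Ioi 2) ∧
      ∀ x ∈ Set.Ioc (0 : ℝ) 2, g x < 0 := by
  refine ⟨g_anti.mono Set.Ioo_subset_Icc_self, g_mono.mono Set.Ioi_subset_Ici_self, ?_⟩
  intro x hx
  have h := g_anti (Set.left_mem_Icc.2 (by norm_num)) (Set.Ioc_subset_Icc_self hx) hx.1
  have h0 : g 0 = 0 := by simp [g]
  rwa [h0] at h
end

section
/- Let C_th be the unique positive solution of ln(1+x) - 3 + 3/(1+x) = 0, and let M ≥ 1 be a real number. If γ₀ ≥ M³ · C_th, then for every real K with 1 ≤ K ≤ M it holds that K · ln(1 + γ₀/K³) ≥ ln(1 + γ₀). (In other words, under this condition the sum-rate of the distributed IRS with K ≤ M user clusters is at least the sum-rate of the centralized IRS.) -/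
/-- Any root of `g` above zero exceeds two. -/
theorem g_root_gt (c : ℝ) (hc : 0 < c) (h : g c = 0) : 2 < c := by
  by_contra hle
  push Not at hle
  unfold g at h
  have hs0 : 1 < Real.sqrt (1 + c) := by
    rw [Real.lt_sqrt] <;> linarith
  have hs2 : Real.sqrt (1 + c) ^ 2 = 1 + c := Real.sq_sqrt (by linarith)
  set s := Real.sqrt (1 + c) with hs
  have hlog : Real.log (1 + c) = 2 * Real.log s := by
    rw [← hs2, Real.log_pow]; norm_num
  have h1 : Real.log s ≤ s - 1 := Real.log_le_sub_one_of_pos (by linarith)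
  have h3 : 3 / (1 + c) * s ^ 2 = 3 := by
    rw [hs2]; field_simp
  have h4 : 3 - 2 * (s - 1) ≤ 3 / (1 + c) := by linarith
  have h5 := mul_le_mul_of_nonneg_right h4 (sq_nonneg s)
  rw [h3] at h5
  have h6 : 0 < (s - 1) * (3 * (s + 1) - 2 * s ^ 2) :=
    mul_pos (by linarith) (by linarith)
  nlinarith

/-- `g` is nonnegative beyond a positive root. -/
theorem g_nonneg (c x : ℝ) (hc : 0 < c) (h : g c = 0) (hx : c ≤ x) : 0 ≤ g x := by
  have h2 := g_root_gt c hc h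
  unfold g at *
  have hx0 : 0 < 1 + x := by linarith
  have hc0 : 0 < 1 + c := by linarith
  have h1 := Real.log_le_sub_one_of_pos (div_pos hc0 hx0)
  rw [Real.log_div hc0.ne' hx0.ne'] at h1
  have h3 : 3 / (1 + c) - 3 / (1 + x) ≤ 1 - (1 + c) / (1 + x) := by
    have : 1 - (1 + c) / (1 + x) - (3 / (1 + c) - 3 / (1 + x))
        = (x - c) * (c - 2) / ((1 + c) * (1 + x)) := by
      field_simp; ring
    have : 0 ≤ (x - c) * (c - 2) / ((1 + c) * (1 + x)) :=
      div_nonneg (mul_nonneg (by linarith) (by linarith)) (by positivity)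
    linarith
  linarith

/-- The derivative of the rate in `K` is `g` at `γ / K ^ 3`. -/
theorem rate_deriv (γ K : ℝ) (hγ : 0 < γ) (hK : 0 < K) :
    HasDerivAt (fun K : ℝ => K * Real.log (1 + γ / K ^ 3)) (g (γ / K ^ 3)) K := by
  have hp : 0 < 1 + γ / K ^ 3 := by positivity
  have h1 : HasDerivAt (fun K : ℝ => 1 + γ / K ^ 3) _ K :=
    ((hasDerivAt_const K γ).fun_div (hasDerivAt_pow 3 K) (by positivity)).const_add 1
  have h2 := (hasDerivAt_id' K).fun_mul (h1.log hp.ne')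
  refine h2.congr_deriv ?_
  unfold g
  have : 0 < K ^ 3 + γ := by positivity
  field_simp
  push_cast
  ring

theorem stmt_5 (Cth : ℝ) (hCth_pos : 0 < Cth) (hCth_root : g Cth = 0)
    (hCth_uniq : ∀ x : ℝ, 0 < x → g x = 0 → x = Cth)
    (M : ℝ) (hM : 1 ≤ M) (γ₀ : ℝ) (hγ₀ : M ^ 3 * Cth ≤ γ₀) :
    ∀ K : ℝ, 1 ≤ K → K ≤ M → Real.log (1 + γ₀) ≤ K * Real.log (1 + γ₀ / K ^ 3) := by
  intro K hK hKM
  have hγ : 0 < γ₀ := lt_of_lt_of_le (by positivity) hγ₀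
  have hmono : MonotoneOn (fun K : ℝ => K * Real.log (1 + γ₀ / K ^ 3)) (Set.Icc 1 M) := by
    apply monotoneOn_of_deriv_nonneg (convex_Icc 1 M)
    · intro y hy
      exact (rate_deriv γ₀ y hγ (by linarith [hy.1])).continuousAt.continuousWithinAt
    · intro y hy
      rw [interior_Icc] at hy
      exact (rate_deriv γ₀ y hγ (by linarith [hy.1])).differentiableAt.differentiableWithinAt
    · intro y hy
      rw [interior_Icc] at hy
      have hy0 : 0 < y := by linarith [hy.1]
      rw [(rate_deriv γ₀ y hγ hy0).deriv]
      apply g_nonneg Cth _ hCth_pos hCth_root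
      rw [le_div_iff₀ (by positivity)]
      have : y ^ 3 ≤ M ^ 3 := pow_le_pow_left₀ hy0.le hy.2.le 3
      nlinarith
  have := hmono (Set.left_mem_Icc.2 hM) ⟨hK, hKM⟩ hK
  simpa using this
end

section
/- For every real K ≥ 2, every real γ > 0 and every real N > 0, the inequality K·(2·log₂ N + log₂ γ - 3·log₂ K) ≥ 2·log₂ N + log₂ γ holds if and only if N ≥ γ^(-1/2) · K^(3K/(2(K-1))). -/
/-- For every real `K ≥ 2`, `γ > 0` and `N > 0`:
`K * (2 * log₂ N + log₂ γ - 3 * log₂ K) ≥ 2 * log₂ N + log₂ γ` if and only if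
`N ≥ γ ^ (-1/2) * K ^ (3 * K / (2 * (K - 1)))`. -/
theorem stmt_6 (K γ N : ℝ) (hK : 2 ≤ K) (hγ : 0 < γ) (hN : 0 < N) :
    2 * Real.logb 2 N + Real.logb 2 γ ≤
        K * (2 * Real.logb 2 N + Real.logb 2 γ - 3 * Real.logb 2 K) ↔
      γ ^ (-(1 / 2) : ℝ) * K ^ (3 * K / (2 * (K - 1))) ≤ N := by
  have hK0 : 0 < K := by linarith
  have hK1 : 0 < K - 1 := by linarith
  have h1 : 0 < γ ^ (-(1 / 2) : ℝ) := Real.rpow_pos_of_pos hγ _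
  have h2 : 0 < K ^ (3 * K / (2 * (K - 1))) := Real.rpow_pos_of_pos hK0 _
  rw [← Real.logb_le_logb (b := 2) (by norm_num) (mul_pos h1 h2) hN,
    Real.logb_mul h1.ne' h2.ne', Real.logb_rpow_eq_mul_logb_of_pos hγ,
    Real.logb_rpow_eq_mul_logb_of_pos hK0]
  generalize Real.logb 2 N = n
  generalize Real.logb 2 γ = g
  generalize Real.logb 2 K = k
  have key : K * (2 * n + g - 3 * k) - (2 * n + g) =
      2 * (K - 1) * (n - (-(1 / 2) * g + 3 * K / (2 * (K - 1)) * k)) := by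
    have := hK1.ne'
    field_simp
    ring
  rw [← sub_nonneg, key, mul_nonneg_iff_of_pos_left (by linarith), sub_nonneg]
end
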